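/- arXiv:1608.00664 — 2 statements merged into one kernel-verified Lean document; each statement's English description precedes it below -/
import Mathlib

section
/- Homotopy invariance of holonomy in the flat case: let V be a real Banach space, let A : ℝ × ℝ → L(V,V) be continuous with a jointly continuous partial derivative ∂_sA in the second variable, let P be an s-differentiable propagator for A, and let B : ℝ × ℝ → L(V,V) be continuous with a jointly continuous partial derivative ∂_tB in the first variable. Suppose that the curvature vanishes, i.e. (∂_sA)(t,s) − (∂_tB)(t,s) + A(t,s) ∘ B(t,s) − B(t,s) ∘ A(t,s) = 0 for all (t,s) ∈ [0,1] × [0,1], and that B(0,s) = 0 and B(1,s) = 0 for all s ∈ [0,1]. Then P(1,0;s) = P(1,0;0) for every s ∈ [0,1]. -/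
/-- Differentiation under the integral sign for a jointly continuous partial derivative. -/
theorem hasDerivAt_intervalIntegral_of_continuous_deriv
    {E : Type*} [NormedAddCommGroup E] [NormedSpace ℝ E]
    {g k : ℝ → ℝ → E} (hg : ∀ s, Continuous fun t => g t s)
    (hgk : ∀ t s, HasDerivAt (fun u => g t u) (k t s) s)
    (hk : Continuous fun p : ℝ × ℝ => k p.1 p.2) (a b s : ℝ) :
    HasDerivAt (fun u => ∫ t in a..b, g t u) (∫ t in a..b, k t s) s := by
  obtain ⟨C, hC⟩ := (isCompact_uIcc.prod (isCompact_closedBall s 1) :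
    IsCompact (Set.uIcc a b ×ˢ Metric.closedBall s 1)).exists_bound_of_continuousOn hk.continuousOn
  have hks : Continuous fun t => k t s := hk.comp (continuous_id.prodMk continuous_const)
  refine (intervalIntegral.hasDerivAt_integral_of_dominated_loc_of_deriv_le
    (F := fun u t => g t u) (F' := fun u t => k t u) (bound := fun _ => C)
    (Metric.closedBall_mem_nhds s one_pos)
    (Filter.Eventually.of_forall fun u => (hg u).aestronglyMeasurable)
    ((hg s).intervalIntegrable a b) hks.aestronglyMeasurable
    (Filter.Eventually.of_forall fun t ht u hu =>
      hC (t, u) ⟨Set.uIoc_subset_uIcc ht, hu⟩)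
    intervalIntegrable_const
    (Filter.Eventually.of_forall fun t _ u _ => hgk t u)).2

/-- Exchange of partial derivatives: if `∂ₜf = g`, `∂ₛf = h`, and `∂ₛg = k` is jointly continuous,
then `∂ₜh = k`. -/
theorem hasDerivAt_partial_swap
    {E : Type*} [NormedAddCommGroup E] [NormedSpace ℝ E] [CompleteSpace E]
    {f g h k : ℝ → ℝ → E} (hfg : ∀ t s, HasDerivAt (fun u => f u s) (g t s) t)
    (hfh : ∀ t s, HasDerivAt (fun u => f t u) (h t s) s)
    (hg : ∀ s, Continuous fun t => g t s)
    (hgk : ∀ t s, HasDerivAt (fun u => g t u) (k t s) s)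
    (hk : Continuous fun p : ℝ × ℝ => k p.1 p.2) (t s : ℝ) :
    HasDerivAt (fun u => h u s) (k t s) t := by
  have hks : Continuous fun t => k t s := hk.comp (continuous_id.prodMk continuous_const)
  have h_eq : (fun u => h u s) = fun u => h t s + ∫ x in t..u, k x s := by
    funext u
    have hf : (fun v => f u v) = fun v => f t v + ∫ x in t..u, g x v := by
      funext v
      rw [intervalIntegral.integral_eq_sub_of_hasDerivAt (fun x _ => hfg x v)
        ((hg v).intervalIntegrable t u)]
      abel
    have hderiv := hfh u s
    rw [hf] at hderiv
    exact hderiv.unique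
      ((hfh t s).add (hasDerivAt_intervalIntegral_of_continuous_deriv hg hgk hk t u s))
  rw [h_eq]
  exact (intervalIntegral.integral_hasDerivAt_right (hks.intervalIntegrable t t)
    (hks.stronglyMeasurableAtFilter _ _) hks.continuousAt).const_add _

/-- A function of two variables, continuous in the first and with a jointly continuous partial
derivative in the second, is jointly continuous. -/
theorem continuous_of_continuous_partial_deriv
    {E : Type*} [NormedAddCommGroup E] [NormedSpace ℝ E] [CompleteSpace E]
    {f h : ℝ → ℝ → E} (hf : ∀ s, Continuous fun t => f t s)
    (hfh : ∀ t s, HasDerivAt (fun u => f t u) (h t s) s)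
    (hh : Continuous fun p : ℝ × ℝ => h p.1 p.2) :
    Continuous fun p : ℝ × ℝ => f p.1 p.2 := by
  have h_eq : (fun p : ℝ × ℝ => f p.1 p.2) =
      fun p => f p.1 0 + ∫ x in (0 : ℝ)..p.2, h p.1 x := by
    funext p
    have hc : Continuous fun x => h p.1 x := hh.comp (continuous_const.prodMk continuous_id)
    rw [intervalIntegral.integral_eq_sub_of_hasDerivAt (fun x _ => hfh p.1 x)
      (hc.intervalIntegrable 0 p.2)]
    abel
  rw [h_eq]
  refine ((hf 0).comp continuous_fst).add
    (intervalIntegral.continuous_parametric_intervalIntegral_of_continuous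
      (f := fun (p : ℝ × ℝ) x => h p.1 x) ?_ continuous_snd)
  exact hh.comp ((continuous_fst.comp continuous_fst).prodMk continuous_snd)

/-- Homotopy invariance of holonomy in the flat case.  If the curvature
`(∂ₛA) − (∂ₜB) + A∘B − B∘A` vanishes on `[0,1] × [0,1]` and `B(0,s) = B(1,s) = 0` for
`s ∈ [0,1]`, then `P(1,0;s) = P(1,0;0)` for all `s ∈ [0,1]`. -/
theorem holonomy_thin_homotopy_invariance
    {V : Type*} [NormedAddCommGroup V] [NormedSpace ℝ V] [CompleteSpace V]
    (A : ℝ → ℝ → V →L[ℝ] V)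
    (hA : Continuous fun p : ℝ × ℝ => A p.1 p.2)
    (As : ℝ → ℝ → V →L[ℝ] V)
    (hAs : ∀ t s, HasDerivAt (fun u => A t u) (As t s) s)
    (hAscont : Continuous fun p : ℝ × ℝ => As p.1 p.2)
    (P : ℝ → ℝ → ℝ → V →L[ℝ] V)
    (hPid : ∀ t s, P t t s = ContinuousLinearMap.id ℝ V)
    (hPcomp : ∀ t'' t' t s, (P t'' t' s).comp (P t' t s) = P t'' t s)
    (hPderiv : ∀ t' t s, HasDerivAt (fun u => P u t s) ((A t' s).comp (P t' t s)) t')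
    (Ps : ℝ → ℝ → ℝ → V →L[ℝ] V)
    (hPs : ∀ t' t s, HasDerivAt (fun u => P t' t u) (Ps t' t s) s)
    (hPscont : Continuous fun p : ℝ × ℝ × ℝ => Ps p.1 p.2.1 p.2.2)
    (B : ℝ → ℝ → V →L[ℝ] V)
    (hB : Continuous fun p : ℝ × ℝ => B p.1 p.2)
    (Bt : ℝ → ℝ → V →L[ℝ] V)
    (hBt : ∀ t s, HasDerivAt (fun u => B u s) (Bt t s) t)
    (hBtcont : Continuous fun p : ℝ × ℝ => Bt p.1 p.2)
    -- flatness: the curvature vanishes on [0,1] × [0,1]: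
    (hflat : ∀ t ∈ Set.Icc (0:ℝ) 1, ∀ s ∈ Set.Icc (0:ℝ) 1,
      As t s - Bt t s + (A t s).comp (B t s) - (B t s).comp (A t s) = 0)
    -- boundary conditions:
    (hB0 : ∀ s ∈ Set.Icc (0:ℝ) 1, B 0 s = 0)
    (hB1 : ∀ s ∈ Set.Icc (0:ℝ) 1, B 1 s = 0) :
    ∀ s ∈ Set.Icc (0:ℝ) 1, P 1 0 s = P 1 0 0 := by
  have hPs0 : Continuous fun p : ℝ × ℝ => Ps p.1 0 p.2 :=
    hPscont.comp (continuous_fst.prodMk (continuous_const.prodMk continuous_snd))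
  have hPt (s : ℝ) : Continuous fun t => P t 0 s :=
    continuous_iff_continuousAt.2 fun t => (hPderiv t 0 s).continuousAt
  have hPcont : Continuous fun p : ℝ × ℝ => P p.1 0 p.2 :=
    continuous_of_continuous_partial_deriv hPt (fun t s => hPs t 0 s) hPs0
  have hPsderiv (t s : ℝ) : HasDerivAt (fun u => Ps u 0 s)
      ((As t s).comp (P t 0 s) + (A t s).comp (Ps t 0 s)) t :=
    hasDerivAt_partial_swap (f := fun t s => P t 0 s)
      (g := fun t s => (A t s).comp (P t 0 s)) (h := fun t s => Ps t 0 s)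
      (k := fun t s => (As t s).comp (P t 0 s) + (A t s).comp (Ps t 0 s))
      (fun t s => hPderiv t 0 s) (fun t s => hPs t 0 s)
      (fun s => (hA.comp (continuous_id.prodMk continuous_const)).clm_comp (hPt s))
      (fun t s => (hAs t s).clm_comp (hPs t 0 s))
      ((hAscont.clm_comp hPcont).add (hA.clm_comp hPs0)) t s
  have hPs_zero : ∀ s ∈ Set.Icc (0 : ℝ) 1, Ps 1 0 s = 0 := by
    intro s hs
    have hinit : Ps 0 0 s = 0 := by
      have hderiv := hPs 0 0 s
      simp only [hPid] at hderiv
      exact hderiv.unique (hasDerivAt_const s _)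
    obtain ⟨C, hC⟩ := (isCompact_Icc : IsCompact (Set.Icc (0 : ℝ) 1)).exists_bound_of_continuousOn
      (f := fun t => A t s) (hA.comp (continuous_id.prodMk continuous_const)).continuousOn
    have hD : ∀ t ∈ Set.Icc (0 : ℝ) 1,
        HasDerivAt (fun u => Ps u 0 s - (B u s).comp (P u 0 s))
          ((A t s).comp (Ps t 0 s - (B t s).comp (P t 0 s))) t := by
      intro t ht
      refine ((hPsderiv t s).sub ((hBt t s).clm_comp (hPderiv t 0 s))).congr_deriv ?_
      have hBt_eq : Bt t s = As t s + (A t s).comp (B t s) - (B t s).comp (A t s) := by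
        rw [← sub_eq_zero, ← neg_eq_zero, ← hflat t ht s hs]
        abel
      rw [hBt_eq]
      ext v
      simp
    have hzero := eq_zero_of_abs_deriv_le_mul_abs_self_of_eq_zero_right (K := C)
      (fun t ht => (hD t ht).continuousAt.continuousWithinAt)
      (fun t ht => (hD t (Set.Ico_subset_Icc_self ht)).hasDerivWithinAt)
      (by simp [hinit, hB0 s hs])
      (fun t ht => (ContinuousLinearMap.opNorm_comp_le _ _).trans
        (mul_le_mul_of_nonneg_right (hC t (Set.Ico_subset_Icc_self ht)) (norm_nonneg _)))
      1 (Set.right_mem_Icc.2 zero_le_one)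
    simpa [hB1 s hs] using hzero
  refine constant_of_has_deriv_right_zero
    (fun s _ => (hPs 1 0 s).continuousAt.continuousWithinAt) fun s hs => ?_
  simpa only [hPs_zero s (Set.Ico_subset_Icc_self hs)] using (hPs 1 0 s).hasDerivWithinAt
end

section
/- The holonomy along a homotopy is a chain homotopy (trivialized form): let C, E be real Banach spaces and ∂ : C → E a continuous linear map. Let A^C, B^C : ℝ × ℝ → L(C,C) and A^E, B^E : ℝ × ℝ → L(E,E) be continuous, with jointly continuous partial derivatives ∂_sA^C, ∂_sA^E (in the second variable) and ∂_tB^C, ∂_tB^E (in the first variable), and let Ω : ℝ × ℝ → L(E,C) be continuous. Let P^C be an s-differentiable propagator for A^C and P^E an s-differentiable propagator for A^E. Assume: (intertwining) ∂ ∘ A^C(t,s) = A^E(t,s) ∘ ∂ and ∂ ∘ B^C(t,s) = B^E(t,s) ∘ ∂ for all (t,s); (curvature relations) ∂ ∘ Ω(t,s) = F^E(t,s) and Ω(t,s) ∘ ∂ = F^C(t,s), where F^X(t,s) := (∂_sA^X)(t,s) − (∂_tB^X)(t,s) + A^X(t,s) ∘ B^X(t,s) − B^X(t,s) ∘ A^X(t,s)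 for X ∈ {C, E}; (boundary) B^C(0,s) = B^C(1,s) = 0 and B^E(0,s) = B^E(1,s) = 0 for all s ∈ [0,1]. Define h := ∫₀¹ ∫₀¹ P^C(1,t;s) ∘ Ω(t,s) ∘ P^E(t,0;s) dt ds ∈ L(E,C). Then ∂ ∘ h = P^E(1,0;1) − P^E(1,0;0) and h ∘ ∂ = P^C(1,0;1) − P^C(1,0;0). -/
/-- If `F` and its derivative `F'` in the first variable are jointly continuous, then
`∫ F x t dt` may be differentiated under the integral sign. -/
theorem hasDerivAt_intervalIntegral_of_continuous {W : Type*} [NormedAddCommGroup W]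
    [NormedSpace ℝ W] {F F' : ℝ → ℝ → W} (hF : Continuous fun p : ℝ × ℝ => F p.1 p.2)
    (hF' : Continuous fun p : ℝ × ℝ => F' p.1 p.2)
    (hderiv : ∀ x t, HasDerivAt (fun y => F y t) (F' x t) x) (a b x₀ : ℝ) :
    HasDerivAt (fun x => ∫ t in a..b, F x t) (∫ t in a..b, F' x₀ t) x₀ := by
  obtain ⟨M, hM⟩ := ((isCompact_closedBall x₀ 1).prod (isCompact_uIcc (a := a) (b := b))
    ).exists_bound_of_continuousOn hF'.continuousOn
  have hslice : ∀ x, Continuous (F x) := fun x => hF.comp (by fun_prop : Continuous (Prod.mk x))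
  have hslice' : Continuous (F' x₀) := hF'.comp (by fun_prop : Continuous (Prod.mk x₀))
  refine (intervalIntegral.hasDerivAt_integral_of_dominated_loc_of_deriv_le
    (bound := fun _ => M) (Metric.closedBall_mem_nhds x₀ one_pos)
    (.of_forall fun x => (hslice x).aestronglyMeasurable)
    ((hslice x₀).intervalIntegrable _ _) hslice'.aestronglyMeasurable
    (.of_forall fun t ht x hx => hM (x, t) ⟨hx, Set.uIoc_subset_uIcc ht⟩)
    intervalIntegrable_const (.of_forall fun t _ x _ => hderiv x t)).2

/-- `P t' t s` is a propagator for the `s`-dependent linear equation `y' = A(t, s) y`. -/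
structure IsPropagator {V : Type*} [NormedAddCommGroup V] [NormedSpace ℝ V]
    (A : ℝ → ℝ → V →L[ℝ] V) (P : ℝ → ℝ → ℝ → V →L[ℝ] V) : Prop where
  self : ∀ t s, P t t s = ContinuousLinearMap.id ℝ V
  comp : ∀ t'' t' t s, (P t'' t' s).comp (P t' t s) = P t'' t s
  hasDerivAt : ∀ t' t s, HasDerivAt (fun u => P u t s) ((A t' s).comp (P t' t s)) t'

namespace IsPropagator

variable {V : Type*} [NormedAddCommGroup V] [NormedSpace ℝ V]
  {A B : ℝ → ℝ → V →L[ℝ] V} {P Ps : ℝ → ℝ → ℝ → V →L[ℝ] V}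

/-- The values of a propagator are invertible. -/
def unit (hP : IsPropagator A P) (t' t s : ℝ) : (V →L[ℝ] V)ˣ where
  val := P t' t s
  inv := P t t' s
  val_inv := (hP.comp t' t t' s).trans (hP.self t' s)
  inv_val := (hP.comp t t' t s).trans (hP.self t s)

theorem inverse_eq (hP : IsPropagator A P) (t' t s : ℝ) :
    Ring.inverse (P t' t s) = P t t' s :=
  Ring.inverse_unit (hP.unit t' t s)

theorem hasDerivAt_right [CompleteSpace V] (hP : IsPropagator A P) (t' t s : ℝ) :
    HasDerivAt (fun u => P t' u s) (-(P t' t s).comp (A t s)) t := by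
  have h := (hasFDerivAt_ringInverse (𝕜 := ℝ) (hP.unit t t' s)).comp_hasDerivAt t
    (hP.hasDerivAt t t' s)
  refine (h.congr_deriv ?_).congr_of_eventuallyEq
    (.of_forall fun u => (hP.inverse_eq u t' s).symm)
  have hval : (((hP.unit t t' s)⁻¹ : (V →L[ℝ] V)ˣ) : V →L[ℝ] V) = P t' t s := rfl
  have hid : P t t' s * P t' t s = 1 := (hP.unit t t' s).val_inv
  simp only [hval, neg_apply, ContinuousLinearMap.mulLeftRight_apply,
    ← ContinuousLinearMap.mul_def, mul_assoc, hid, mul_one]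

theorem continuous [CompleteSpace V] (hP : IsPropagator A P)
    (hPs : ∀ t' t s, HasDerivAt (fun u => P t' t u) (Ps t' t s) s)
    (hPs_cont : Continuous fun p : ℝ × ℝ × ℝ => Ps p.1 p.2.1 p.2.2) :
    Continuous fun p : ℝ × ℝ × ℝ => P p.1 p.2.1 p.2.2 := by
  have hslice : ∀ t' t, Continuous (Ps t' t) := fun t' t =>
    hPs_cont.comp (by fun_prop : Continuous fun s : ℝ => (t', t, s))
  have heq : ∀ p : ℝ × ℝ × ℝ, P p.1 p.2.1 p.2.2 =
      (P p.1 0 0).comp (P 0 p.2.1 0) + ∫ u in (0 : ℝ)..p.2.2, Ps p.1 p.2.1 u := fun p => by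
    rw [intervalIntegral.integral_eq_sub_of_hasDerivAt (fun u _ => hPs p.1 p.2.1 u)
      ((hslice _ _).intervalIntegrable _ _), hP.comp, add_sub_cancel]
  simp_rw [heq]
  have hleft : Continuous fun t => P t 0 0 :=
    continuous_iff_continuousAt.2 fun t => (hP.hasDerivAt t 0 0).continuousAt
  have hright : Continuous fun t => P 0 t 0 :=
    continuous_iff_continuousAt.2 fun t => (hP.hasDerivAt_right 0 t 0).continuousAt
  refine ((hleft.comp continuous_fst).clm_comp
    (hright.comp (continuous_fst.comp continuous_snd))).add ?_
  exact intervalIntegral.continuous_parametric_intervalIntegral_of_continuous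
    (f := fun (p : ℝ × ℝ × ℝ) u => Ps p.1 p.2.1 u)
    (hPs_cont.comp (by fun_prop : Continuous fun q : (ℝ × ℝ × ℝ) × ℝ => (q.1.1, q.1.2.1, q.2)))
    (continuous_snd.comp continuous_snd)

/-- Propagators of intertwined equations are intertwined. -/
theorem intertwine {C E : Type*} [NormedAddCommGroup C] [NormedSpace ℝ C]
    [NormedAddCommGroup E] [NormedSpace ℝ E] [CompleteSpace E]
    {AC : ℝ → ℝ → C →L[ℝ] C} {AE : ℝ → ℝ → E →L[ℝ] E}
    {PC : ℝ → ℝ → ℝ → C →L[ℝ] C} {PE : ℝ → ℝ → ℝ → E →L[ℝ] E}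
    (hPC : IsPropagator AC PC) (hPE : IsPropagator AE PE) {d : C →L[ℝ] E}
    (hd : ∀ t s, d.comp (AC t s) = (AE t s).comp d) (t' t s : ℝ) :
    d.comp (PC t' t s) = (PE t' t s).comp d := by
  have hderiv : ∀ u, HasDerivAt (fun u => (PE t' u s).comp (d.comp (PC u t s))) 0 u := fun u => by
    refine ((hPE.hasDerivAt_right t' u s).clm_comp
      ((hasDerivAt_const u d).clm_comp (hPC.hasDerivAt u t s))).congr_deriv ?_
    rw [← ContinuousLinearMap.comp_assoc d, hd]
    ext x
    simp
  have h := is_const_of_deriv_eq_zero (fun u => (hderiv u).differentiableAt)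
    (fun u => (hderiv u).deriv) t' t
  simpa [hPE.self, hPC.self] using h

theorem sub_eq_integral [CompleteSpace V] (hP : IsPropagator A P)
    (hA : Continuous fun p : ℝ × ℝ => A p.1 p.2)
    (hcont : Continuous fun p : ℝ × ℝ × ℝ => P p.1 p.2.1 p.2.2) (a b s s₀ : ℝ) :
    P b a s - P b a s₀ =
      ∫ t in a..b, (P b t s₀).comp ((A t s - A t s₀).comp (P t a s)) := by
  have hderiv : ∀ t, HasDerivAt (fun u => (P b u s₀).comp (P u a s))
      ((P b t s₀).comp ((A t s - A t s₀).comp (P t a s))) t := fun t => by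
    refine ((hP.hasDerivAt_right b t s₀).clm_comp (hP.hasDerivAt t a s)).congr_deriv ?_
    ext x
    simp [sub_eq_neg_add]
  have hcontA : ∀ s, Continuous fun t => A t s := fun s =>
    hA.comp (by fun_prop : Continuous fun t : ℝ => (t, s))
  have hcontl : Continuous fun t => P b t s₀ :=
    hcont.comp (by fun_prop : Continuous fun t : ℝ => (b, t, s₀))
  have hcontr : Continuous fun t => P t a s :=
    hcont.comp (by fun_prop : Continuous fun t : ℝ => (t, a, s))
  rw [intervalIntegral.integral_eq_sub_of_hasDerivAt (fun t _ => hderiv t)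
    ((hcontl.clm_comp (((hcontA s).sub (hcontA s₀)).clm_comp hcontr)).intervalIntegrable _ _)]
  simp [hP.self]

/-- Duhamel's formula for the derivative of a propagator in the parameter. -/
theorem deriv_param_eq_integral [CompleteSpace V] (hP : IsPropagator A P)
    (hA : Continuous fun p : ℝ × ℝ => A p.1 p.2) {As : ℝ → ℝ → V →L[ℝ] V}
    (hAs : ∀ t s, HasDerivAt (fun u => A t u) (As t s) s)
    (hAs_cont : Continuous fun p : ℝ × ℝ => As p.1 p.2)
    (hPs : ∀ t' t s, HasDerivAt (fun u => P t' t u) (Ps t' t s) s)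
    (hPs_cont : Continuous fun p : ℝ × ℝ × ℝ => Ps p.1 p.2.1 p.2.2) (a b s₀ : ℝ) :
    Ps b a s₀ = ∫ t in a..b, (P b t s₀).comp ((As t s₀).comp (P t a s₀)) := by
  have hcont := hP.continuous hPs hPs_cont
  have hcontl : Continuous fun p : ℝ × ℝ => P b p.2 s₀ :=
    hcont.comp (by fun_prop : Continuous fun p : ℝ × ℝ => (b, p.2, s₀))
  have hcontr : Continuous fun p : ℝ × ℝ => P p.2 a p.1 :=
    hcont.comp (by fun_prop : Continuous fun p : ℝ × ℝ => (p.2, a, p.1))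
  have hcontr' : Continuous fun p : ℝ × ℝ => Ps p.2 a p.1 :=
    hPs_cont.comp (by fun_prop : Continuous fun p : ℝ × ℝ => (p.2, a, p.1))
  have hcontA : Continuous fun p : ℝ × ℝ => A p.2 p.1 - A p.2 s₀ :=
    (hA.comp continuous_swap).sub
      (hA.comp (by fun_prop : Continuous fun p : ℝ × ℝ => (p.2, s₀)))
  have hint := hasDerivAt_intervalIntegral_of_continuous
    (F := fun s t => (P b t s₀).comp ((A t s - A t s₀).comp (P t a s)))
    (F' := fun s t => (P b t s₀).comp
      ((As t s).comp (P t a s) + (A t s - A t s₀).comp (Ps t a s)))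
    (hcontl.clm_comp (hcontA.clm_comp hcontr))
    (hcontl.clm_comp (((hAs_cont.comp continuous_swap).clm_comp hcontr).add
      (hcontA.clm_comp hcontr')))
    (fun s t => by
      refine ((hasDerivAt_const s (P b t s₀)).clm_comp
        (((hAs t s).sub_const (A t s₀)).clm_comp (hPs t a s))).congr_deriv ?_
      simp) a b s₀
  simp_rw [← hP.sub_eq_integral hA hcont] at hint
  simpa using ((hPs b a s₀).sub_const (P b a s₀)).unique hint

/-- The variation of the propagator along a homotopy is the integral of the curvature
`∂ₛA - ∂ₜB + [A, B]` when `B` vanishes at both ends. -/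
theorem integral_curvature [CompleteSpace V] (hP : IsPropagator A P)
    (hA : Continuous fun p : ℝ × ℝ => A p.1 p.2) (hB : Continuous fun p : ℝ × ℝ => B p.1 p.2)
    {As Bt : ℝ → ℝ → V →L[ℝ] V}
    (hAs : ∀ t s, HasDerivAt (fun u => A t u) (As t s) s)
    (hAs_cont : Continuous fun p : ℝ × ℝ => As p.1 p.2)
    (hBt : ∀ t s, HasDerivAt (fun u => B u s) (Bt t s) t)
    (hBt_cont : Continuous fun p : ℝ × ℝ => Bt p.1 p.2)
    (hPs : ∀ t' t s, HasDerivAt (fun u => P t' t u) (Ps t' t s) s)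
    (hPs_cont : Continuous fun p : ℝ × ℝ × ℝ => Ps p.1 p.2.1 p.2.2) {a b s₀ s₁ : ℝ}
    (ha : ∀ s ∈ Set.uIcc s₀ s₁, B a s = 0) (hb : ∀ s ∈ Set.uIcc s₀ s₁, B b s = 0) :
    ∫ s in s₀..s₁, ∫ t in a..b, (P b t s).comp
      ((As t s - Bt t s + (A t s).comp (B t s) - (B t s).comp (A t s)).comp (P t a s)) =
      P b a s₁ - P b a s₀ := by
  have hcont := hP.continuous hPs hPs_cont
  have hinner : ∀ s ∈ Set.uIcc s₀ s₁, ∫ t in a..b, (P b t s).comp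
      ((As t s - Bt t s + (A t s).comp (B t s) - (B t s).comp (A t s)).comp (P t a s)) =
      Ps b a s := fun s hs => by
    have hslice : ∀ {G : ℝ → ℝ → V →L[ℝ] V}, (Continuous fun p : ℝ × ℝ => G p.1 p.2) →
        Continuous fun t => G t s := fun hG =>
      hG.comp (by fun_prop : Continuous fun t : ℝ => (t, s))
    have hcontl : Continuous fun t => P b t s :=
      hcont.comp (by fun_prop : Continuous fun t : ℝ => (b, t, s))
    have hcontr : Continuous fun t => P t a s :=
      hcont.comp (by fun_prop : Continuous fun t : ℝ => (t, a, s))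
    have hderiv : ∀ t, HasDerivAt (fun u => (P b u s).comp ((B u s).comp (P u a s)))
        ((P b t s).comp
          ((Bt t s - (A t s).comp (B t s) + (B t s).comp (A t s)).comp (P t a s))) t := fun t => by
      refine ((hP.hasDerivAt_right b t s).clm_comp
        ((hBt t s).clm_comp (hP.hasDerivAt t a s))).congr_deriv ?_
      ext x
      simp only [add_apply, sub_apply,
        neg_apply, ContinuousLinearMap.comp_apply, map_add, map_sub]
      abel
    have hint : IntervalIntegrable (fun t => (P b t s).comp
        ((Bt t s - (A t s).comp (B t s) + (B t s).comp (A t s)).comp (P t a s)))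
        MeasureTheory.volume a b :=
      (hcontl.clm_comp ((((hslice hBt_cont).sub ((hslice hA).clm_comp (hslice hB))).add
        ((hslice hB).clm_comp (hslice hA))).clm_comp hcontr)).intervalIntegrable _ _
    have hzero := intervalIntegral.integral_eq_sub_of_hasDerivAt (fun t _ => hderiv t) hint
    rw [ha s hs, hb s hs, ContinuousLinearMap.zero_comp, ContinuousLinearMap.zero_comp,
      ContinuousLinearMap.comp_zero, ContinuousLinearMap.comp_zero, sub_zero] at hzero
    rw [hP.deriv_param_eq_integral hA hAs hAs_cont hPs hPs_cont, ← sub_zero (∫ t in a..b,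
      (P b t s).comp ((As t s).comp (P t a s))), ← hzero, ← intervalIntegral.integral_sub
      ((hcontl.clm_comp ((hslice hAs_cont).clm_comp hcontr)).intervalIntegrable _ _) hint]
    refine intervalIntegral.integral_congr fun t _ => ?_
    ext x
    simp only [add_apply, sub_apply,
      ContinuousLinearMap.comp_apply, map_add, map_sub]
    abel
  rw [intervalIntegral.integral_congr hinner]
  exact intervalIntegral.integral_eq_sub_of_hasDerivAt (fun s _ => hPs b a s)
    ((hPs_cont.comp (by fun_prop : Continuous fun s : ℝ => (b, a, s))).intervalIntegrable _ _)

end IsPropagator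

/-- A continuous linear map commutes with the iterated integral of a jointly continuous map. -/
theorem ContinuousLinearMap.intervalIntegral_intervalIntegral_comp_comm {V W : Type*}
    [NormedAddCommGroup V] [NormedSpace ℝ V] [CompleteSpace V]
    [NormedAddCommGroup W] [NormedSpace ℝ W] [CompleteSpace W] (L : V →L[ℝ] W) {f : ℝ → ℝ → V}
    (hf : Continuous fun p : ℝ × ℝ => f p.1 p.2) (a b a' b' : ℝ) :
    L (∫ s in a..b, ∫ t in a'..b', f s t) = ∫ s in a..b, ∫ t in a'..b', L (f s t) := by
  have hslice : ∀ s, Continuous (f s) := fun s => hf.comp (by fun_prop : Continuous (Prod.mk s))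
  rw [← L.intervalIntegral_comp_comm
    ((intervalIntegral.continuous_parametric_intervalIntegral_of_continuous' hf a' b'
      ).intervalIntegrable _ _)]
  exact intervalIntegral.integral_congr fun s _ =>
    (L.intervalIntegral_comp_comm ((hslice s).intervalIntegrable _ _)).symm

/-- The holonomy along a homotopy is a chain homotopy (trivialized form).
With intertwined data `(A^C, B^C)` on `C` and `(A^E, B^E)` on `E`, curvature relations
`∂ ∘ Ω = F^E` and `Ω ∘ ∂ = F^C`, and boundary conditions `B(0,s) = B(1,s) = 0`, the
operator `h = ∫₀¹∫₀¹ P^C(1,t;s) ∘ Ω(t,s) ∘ P^E(t,0;s) dt ds` satisfies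
`∂ ∘ h = P^E(1,0;1) − P^E(1,0;0)` and `h ∘ ∂ = P^C(1,0;1) − P^C(1,0;0)`. -/
theorem holonomy_of_homotopy_is_chain_homotopy
    {C E : Type*} [NormedAddCommGroup C] [NormedSpace ℝ C] [CompleteSpace C]
    [NormedAddCommGroup E] [NormedSpace ℝ E] [CompleteSpace E]
    (d : C →L[ℝ] E)
    (AC BC : ℝ → ℝ → C →L[ℝ] C) (AE BE : ℝ → ℝ → E →L[ℝ] E)
    (Om : ℝ → ℝ → E →L[ℝ] C)
    (hAC : Continuous fun p : ℝ × ℝ => AC p.1 p.2)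
    (hBC : Continuous fun p : ℝ × ℝ => BC p.1 p.2)
    (hAE : Continuous fun p : ℝ × ℝ => AE p.1 p.2)
    (hBE : Continuous fun p : ℝ × ℝ => BE p.1 p.2)
    (hOm : Continuous fun p : ℝ × ℝ => Om p.1 p.2)
    (AsC : ℝ → ℝ → C →L[ℝ] C)
    (hAsC : ∀ t s, HasDerivAt (fun u => AC t u) (AsC t s) s)
    (hAsCcont : Continuous fun p : ℝ × ℝ => AsC p.1 p.2)
    (AsE : ℝ → ℝ → E →L[ℝ] E)
    (hAsE : ∀ t s, HasDerivAt (fun u => AE t u) (AsE t s) s)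
    (hAsEcont : Continuous fun p : ℝ × ℝ => AsE p.1 p.2)
    (BtC : ℝ → ℝ → C →L[ℝ] C)
    (hBtC : ∀ t s, HasDerivAt (fun u => BC u s) (BtC t s) t)
    (hBtCcont : Continuous fun p : ℝ × ℝ => BtC p.1 p.2)
    (BtE : ℝ → ℝ → E →L[ℝ] E)
    (hBtE : ∀ t s, HasDerivAt (fun u => BE u s) (BtE t s) t)
    (hBtEcont : Continuous fun p : ℝ × ℝ => BtE p.1 p.2)
    -- propagators:
    (PC : ℝ → ℝ → ℝ → C →L[ℝ] C)
    (hPCid : ∀ t s, PC t t s = ContinuousLinearMap.id ℝ C)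
    (hPCcomp : ∀ t'' t' t s, (PC t'' t' s).comp (PC t' t s) = PC t'' t s)
    (hPCderiv : ∀ t' t s, HasDerivAt (fun u => PC u t s) ((AC t' s).comp (PC t' t s)) t')
    (PsC : ℝ → ℝ → ℝ → C →L[ℝ] C)
    (hPsC : ∀ t' t s, HasDerivAt (fun u => PC t' t u) (PsC t' t s) s)
    (hPsCcont : Continuous fun p : ℝ × ℝ × ℝ => PsC p.1 p.2.1 p.2.2)
    (PE : ℝ → ℝ → ℝ → E →L[ℝ] E)
    (hPEid : ∀ t s, PE t t s = ContinuousLinearMap.id ℝ E)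
    (hPEcomp : ∀ t'' t' t s, (PE t'' t' s).comp (PE t' t s) = PE t'' t s)
    (hPEderiv : ∀ t' t s, HasDerivAt (fun u => PE u t s) ((AE t' s).comp (PE t' t s)) t')
    (PsE : ℝ → ℝ → ℝ → E →L[ℝ] E)
    (hPsE : ∀ t' t s, HasDerivAt (fun u => PE t' t u) (PsE t' t s) s)
    (hPsEcont : Continuous fun p : ℝ × ℝ × ℝ => PsE p.1 p.2.1 p.2.2)
    -- intertwining:
    (hintA : ∀ t s, d.comp (AC t s) = (AE t s).comp d)
    (hintB : ∀ t s, d.comp (BC t s) = (BE t s).comp d)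
    -- curvature relations:
    (hcurvE : ∀ t s, d.comp (Om t s) =
      AsE t s - BtE t s + (AE t s).comp (BE t s) - (BE t s).comp (AE t s))
    (hcurvC : ∀ t s, (Om t s).comp d =
      AsC t s - BtC t s + (AC t s).comp (BC t s) - (BC t s).comp (AC t s))
    -- boundary conditions:
    (hBC0 : ∀ s ∈ Set.Icc (0:ℝ) 1, BC 0 s = 0)
    (hBC1 : ∀ s ∈ Set.Icc (0:ℝ) 1, BC 1 s = 0)
    (hBE0 : ∀ s ∈ Set.Icc (0:ℝ) 1, BE 0 s = 0)
    (hBE1 : ∀ s ∈ Set.Icc (0:ℝ) 1, BE 1 s = 0) :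
    d.comp (∫ s in (0:ℝ)..1, ∫ t in (0:ℝ)..1,
        (PC 1 t s).comp ((Om t s).comp (PE t 0 s))) = PE 1 0 1 - PE 1 0 0 ∧
    (∫ s in (0:ℝ)..1, ∫ t in (0:ℝ)..1,
        (PC 1 t s).comp ((Om t s).comp (PE t 0 s))).comp d = PC 1 0 1 - PC 1 0 0 := by
  have hPC : IsPropagator AC PC := ⟨hPCid, hPCcomp, hPCderiv⟩
  have hPE : IsPropagator AE PE := ⟨hPEid, hPEcomp, hPEderiv⟩
  have hint := hPC.intertwine hPE hintA
  have hcont : Continuous fun p : ℝ × ℝ => (PC 1 p.2 p.1).comp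
      ((Om p.2 p.1).comp (PE p.2 0 p.1)) :=
    ((hPC.continuous hPsC hPsCcont).comp
      (by fun_prop : Continuous fun p : ℝ × ℝ => ((1 : ℝ), p.2, p.1))).clm_comp
      ((hOm.comp continuous_swap).clm_comp ((hPE.continuous hPsE hPsEcont).comp
        (by fun_prop : Continuous fun p : ℝ × ℝ => (p.2, (0 : ℝ), p.1))))
  rw [← Set.uIcc_of_le zero_le_one] at hBC0 hBC1 hBE0 hBE1
  constructor
  · rw [← hPE.integral_curvature hAE hBE hAsE hAsEcont hBtE hBtEcont hPsE hPsEcont hBE0 hBE1]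
    refine ((ContinuousLinearMap.compL ℝ E C E d
      ).intervalIntegral_intervalIntegral_comp_comm hcont 0 1 0 1).trans ?_
    simp_rw [ContinuousLinearMap.compL_apply, ← hcurvE, ← ContinuousLinearMap.comp_assoc, hint]
  · rw [← hPC.integral_curvature hAC hBC hAsC hAsCcont hBtC hBtCcont hPsC hPsCcont hBC0 hBC1]
    refine (((ContinuousLinearMap.compL ℝ C E C).flip d
      ).intervalIntegral_intervalIntegral_comp_comm hcont 0 1 0 1).trans ?_
    simp_rw [ContinuousLinearMap.flip_apply, ContinuousLinearMap.compL_apply, ← hcurvC,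
      ContinuousLinearMap.comp_assoc, hint]
end
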